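/- arXiv:2005.11990 — 2 statements merged into one kernel-verified Lean document; each statement's English description precedes it below -/
import Mathlib

section
/- Let θ ∈ (π, 2π) be fixed. Then for all x, y ∈ S_θ, the inequality s_{S_θ}(x,y) ≤ 2·sin(θ/4)·j*_{S_θ}(x,y) holds. -/
open Set Metric Complex

/-- The open sector of angle `θ`: points with polar angle strictly between `0` and `θ`. -/
noncomputable def sector (θ : ℝ) : Set ℂ :=
  {z : ℂ | ∃ r φ : ℝ, 0 < r ∧ 0 < φ ∧ φ < θ ∧ z = r * Complex.exp (φ * Complex.I)}

/-- Distance from `x` to the boundary of `G`. -/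
noncomputable def distBd (G : Set ℂ) (x : ℂ) : ℝ :=
  Metric.infDist x (frontier G)

/-- The triangular ratio metric `s_G`. -/
noncomputable def triRatio (G : Set ℂ) (x y : ℂ) : ℝ :=
  dist x y / sInf ((fun z => dist x z + dist z y) '' frontier G)

/-- The `j*`-metric. -/
noncomputable def jStar (G : Set ℂ) (x y : ℂ) : ℝ :=
  dist x y / (dist x y + 2 * min (distBd G x) (distBd G y))

/-- The point pair function `p_G`. -/
noncomputable def pointPair (G : Set ℂ) (x y : ℂ) : ℝ :=
  dist x y / Real.sqrt (dist x y ^ 2 + 4 * distBd G x * distBd G y)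

theorem Real.sin_sq_add_two_mul_sin_le {c m : ℝ} (h₁ : Real.pi / 4 ≤ c) (h₂ : c ≤ Real.pi / 2) :
    Real.sin m ^ 2 + 2 * Real.sin c * Real.sin (2 * c - m) ≤ 3 * Real.sin c ^ 2 := by
  obtain ⟨e, rfl⟩ : ∃ e, m = c + e := ⟨m - c, by ring⟩
  have hK : 0 ≤ Real.cos c :=
    Real.cos_nonneg_of_neg_pi_div_two_le_of_le (by linarith [Real.pi_pos]) h₂
  have hSK : Real.cos c ≤ Real.sin c := by
    rw [← Real.sin_pi_div_two_sub]
    exact Real.sin_le_sin_of_le_of_le_pi_div_two (by linarith) h₂ (by linarith)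
  rw [show 2 * c - (c + e) = c - e by ring, Real.sin_add, Real.sin_sub]
  have hσ := Real.sin_sq_add_cos_sq e
  have h3 : Real.cos c ^ 2 ≤ Real.sin c ^ 2 := by gcongr
  have h4 : 0 ≤ Real.sin c ^ 2 + Real.sin c * Real.cos c * Real.sin e := by
    nlinarith [mul_nonneg hK (hK.trans hSK), Real.neg_one_le_sin e,
      mul_le_mul_of_nonneg_left hSK (hK.trans hSK)]
  have h5 : 0 ≤ Real.sin c ^ 2 * (3 + Real.cos e) + 2 * Real.sin c * Real.cos c * Real.sin e -
      Real.cos c ^ 2 * (1 + Real.cos e) := by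
    nlinarith [mul_nonneg (sub_nonneg.2 h3)
      (by linarith [Real.neg_one_le_cos e] : 0 ≤ 1 + Real.cos e)]
  have h6 := mul_nonneg (sub_nonneg.2 (Real.cos_le_one e)) h5
  have h7 : Real.sin e ^ 2 = 1 - Real.cos e ^ 2 := by linarith
  have h8 : (Real.sin c * Real.cos e + Real.cos c * Real.sin e) ^ 2 =
      Real.sin c ^ 2 * Real.cos e ^ 2 + 2 * Real.sin c * Real.cos c * Real.sin e * Real.cos e +
        Real.cos c ^ 2 * (1 - Real.cos e ^ 2) := by
    rw [← h7]; ring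
  rw [h8]
  linarith

theorem Real.sin_sq_half_add_sin_add_sin_le {c v a b : ℝ}
    (h₁ : Real.pi / 4 ≤ c) (h₂ : c ≤ Real.pi / 2)
    (hv : 0 ≤ v) (ha : 0 ≤ a) (ha' : a ≤ Real.pi / 2) (hb : 0 ≤ b) (hb' : b ≤ Real.pi / 2)
    (hle : v ≤ 2 * c - (a + b) / 2) :
    Real.sin v ^ 2 + Real.sin c * (Real.sin a + Real.sin b) ≤ 3 * Real.sin c ^ 2 := by
  have hM : 0 ≤ Real.sin c :=
    Real.sin_nonneg_of_nonneg_of_le_pi (by linarith [Real.pi_pos]) (by linarith [Real.pi_pos])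
  have hu : 0 ≤ Real.sin ((a + b) / 2) :=
    Real.sin_nonneg_of_nonneg_of_le_pi (by linarith) (by linarith [Real.pi_pos])
  have hsum : Real.sin a + Real.sin b ≤ 2 * Real.sin ((a + b) / 2) := by
    rw [Real.sin_add_sin]
    exact mul_le_of_le_one_right (by linarith) (Real.cos_le_one _)
  have hsum' := mul_le_mul_of_nonneg_left hsum hM
  rcases le_total (2 * c - (a + b) / 2) (Real.pi / 2) with hw | hw
  · have key := Real.sin_sq_add_two_mul_sin_le (m := 2 * c - (a + b) / 2) h₁ h₂
    rw [sub_sub_cancel] at key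
    have hs : Real.sin v ≤ Real.sin (2 * c - (a + b) / 2) :=
      Real.sin_le_sin_of_le_of_le_pi_div_two (by linarith [Real.pi_pos]) hw hle
    have hs0 : 0 ≤ Real.sin v := Real.sin_nonneg_of_nonneg_of_le_pi hv (by linarith [Real.pi_pos])
    have : Real.sin v ^ 2 ≤ Real.sin (2 * c - (a + b) / 2) ^ 2 := by gcongr
    linarith
  · have key := Real.sin_sq_add_two_mul_sin_le (m := Real.pi / 2) h₁ h₂
    rw [Real.sin_pi_div_two] at key
    have hs : Real.sin ((a + b) / 2) ≤ Real.sin (2 * c - Real.pi / 2) :=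
      Real.sin_le_sin_of_le_of_le_pi_div_two (by linarith [Real.pi_pos]) (by linarith) (by linarith)
    have := mul_le_mul_of_nonneg_left hs hM
    linarith [Real.sin_sq_le_one v]

theorem norm_polar_sub_polar_sq (r s φ ψ : ℝ) :
    ‖(r * exp (φ * I) - s * exp (ψ * I) : ℂ)‖ ^ 2 =
      r ^ 2 + s ^ 2 - 2 * r * s * Real.cos (ψ - φ) := by
  rw [Complex.sq_norm, normSq_apply]
  simp only [sub_re, sub_im, re_ofReal_mul, im_ofReal_mul, exp_ofReal_mul_I_re,
    exp_ofReal_mul_I_im, Real.cos_sub]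
  linear_combination r ^ 2 * Real.sin_sq_add_cos_sq φ + s ^ 2 * Real.sin_sq_add_cos_sq ψ

theorem norm_polar (r φ : ℝ) (hr : 0 ≤ r) : ‖(r * exp (φ * I) : ℂ)‖ = r := by
  rw [norm_mul, norm_exp_ofReal_mul_I, mul_one, norm_real, Real.norm_of_nonneg hr]

theorem norm_polar_sub_add_two_mul_le {c r s φ ψ d : ℝ}
    (h₁ : Real.pi / 4 ≤ c) (h₂ : c ≤ Real.pi / 2)
    (hr : 0 < r) (hs : 0 < s) (hφ : 0 ≤ φ) (hφψ : φ ≤ ψ) (hψ : ψ ≤ 4 * c)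
    (hdr : d ≤ r * Real.sin (min φ (Real.pi / 2)))
    (hds : d ≤ s * Real.sin (min (4 * c - ψ) (Real.pi / 2))) :
    ‖(r * exp (φ * I) - s * exp (ψ * I) : ℂ)‖ + 2 * d ≤ 2 * Real.sin c * (r + s) := by
  have hn := norm_polar_sub_polar_sq r s φ ψ
  set n := ‖(r * exp (φ * I) - s * exp (ψ * I) : ℂ)‖
  set a := min φ (Real.pi / 2)
  set b := min (4 * c - ψ) (Real.pi / 2)
  have hpi := Real.pi_pos
  have key := Real.sin_sq_half_add_sin_add_sin_le (v := (ψ - φ) / 2) (a := a) (b := b) h₁ h₂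
    (by linarith) (le_min hφ (by linarith)) (min_le_right _ _) (le_min (by linarith) (by linarith))
    (min_le_right _ _)
    (by linarith [min_le_left φ (Real.pi / 2), min_le_left (4 * c - ψ) (Real.pi / 2)])
  have hcos : Real.cos (ψ - φ) = 1 - 2 * Real.sin ((ψ - φ) / 2) ^ 2 := by
    rw [← mul_div_cancel₀ (ψ - φ) (two_ne_zero (α := ℝ)), Real.cos_two_mul, Real.cos_sq']
    ring_nf
  have hM : 0 < Real.sin c := Real.sin_pos_of_pos_of_lt_pi (by linarith) (by linarith)
  have hM2 : 1 / 2 ≤ Real.sin c ^ 2 := by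
    have h := Real.cos_nonpos_of_pi_div_two_le_of_le (x := 2 * c) (by linarith) (by linarith)
    rw [Real.cos_two_mul, Real.cos_sq'] at h
    linarith
  have hd : d * (r + s) ≤ r * s * (Real.sin a + Real.sin b) := by
    linarith [mul_le_mul_of_nonneg_left hdr hs.le, mul_le_mul_of_nonneg_left hds hr.le]
  have hd' := mul_le_mul_of_nonneg_left hd hM.le
  have hkey := mul_le_mul_of_nonneg_left key (mul_pos hr hs).le
  rw [hcos] at hn
  have hamgm : 0 ≤ (3 * Real.sin c ^ 2 - 1) * (r - s) ^ 2 :=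
    mul_nonneg (by linarith) (sq_nonneg _)
  have hpos : 0 < Real.sin c * (r + s) := by positivity
  have hsq : 2 * (Real.sin c * (r + s)) * n ≤ n ^ 2 + (Real.sin c * (r + s)) ^ 2 := by
    linarith [sq_nonneg (n - Real.sin c * (r + s))]
  refine le_of_mul_le_mul_left ?_ hpos
  linarith

theorem mem_sector_iff {θ : ℝ} (h₁ : Real.pi < θ) (h₂ : θ < 2 * Real.pi) {z : ℂ} :
    z ∈ sector θ ↔ 0 < z.im ∨ z.im * Real.cos θ < z.re * Real.sin θ := by
  have hpi := Real.pi_pos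
  constructor
  · rintro ⟨r, φ, hr, h0, hφ, rfl⟩
    simp only [re_ofReal_mul, im_ofReal_mul, exp_ofReal_mul_I_re, exp_ofReal_mul_I_im]
    rcases lt_or_ge φ Real.pi with h | h
    · exact .inl (mul_pos hr (Real.sin_pos_of_pos_of_lt_pi h0 h))
    · have := mul_pos hr (Real.sin_pos_of_pos_of_lt_pi (x := θ - φ) (by linarith) (by linarith))
      rw [Real.sin_sub] at this
      exact .inr (by linarith)
  · rintro (h | h)
    · have h0 : z ≠ 0 := by rintro rfl; simp at h
      refine ⟨‖z‖, arg z, norm_pos_iff.2 h0, ?_, (arg_le_pi z).trans_lt h₁,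
        (norm_mul_exp_arg_mul_I z).symm⟩
      refine (arg_nonneg_iff.2 h.le).lt_of_ne' fun h' => ?_
      exact h.ne' (arg_eq_zero_iff.1 h').2
    · set w := z * exp (-(θ * I)) with hw
      have hwz : z = w * exp (θ * I) := by
        rw [hw, mul_assoc, ← Complex.exp_add, neg_add_cancel, Complex.exp_zero, mul_one]
      have hwim : w.im < 0 := by
        rw [hw, ← neg_mul, ← ofReal_neg, mul_im, exp_ofReal_mul_I_re, exp_ofReal_mul_I_im,
          Real.cos_neg, Real.sin_neg]
        linarith
      have h0 : w ≠ 0 := by intro h'; simp [h'] at hwim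
      refine ⟨‖w‖, arg w + θ, norm_pos_iff.2 h0, by linarith [neg_pi_lt_arg w],
        by linarith [arg_neg_iff.2 hwim], ?_⟩
      rw [ofReal_add, add_mul, Complex.exp_add, ← mul_assoc, norm_mul_exp_arg_mul_I, ← hwz]

theorem isOpen_sector {θ : ℝ} (h₁ : Real.pi < θ) (h₂ : θ < 2 * Real.pi) : IsOpen (sector θ) := by
  have : sector θ = {z : ℂ | 0 < z.im} ∪ {z : ℂ | z.im * Real.cos θ < z.re * Real.sin θ} := by
    ext z
    exact mem_sector_iff h₁ h₂
  rw [this]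
  exact (isOpen_lt (by fun_prop) (by fun_prop)).union (isOpen_lt (by fun_prop) (by fun_prop))

theorem IsPreconnected.inter_frontier_nonempty {X : Type*} [TopologicalSpace X] {s G : Set X}
    (hs : IsPreconnected s) (h : (s ∩ G).Nonempty) (h' : (s ∩ Gᶜ).Nonempty) :
    (s ∩ frontier G).Nonempty := by
  by_contra hne
  have hsub : s ⊆ interior G ∪ interior Gᶜ := by
    rw [← compl_frontier_eq_union_interior]
    exact fun w hw hwG => hne ⟨w, hw, hwG⟩
  obtain ⟨x, hxs, hxG⟩ := h
  obtain ⟨p, hps, hpG⟩ := h'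
  obtain ⟨w, -, hw, hw'⟩ := hs _ _ isOpen_interior isOpen_interior hsub
    ⟨x, hxs, (hsub hxs).resolve_right fun h => interior_subset h hxG⟩
    ⟨p, hps, (hsub hps).resolve_left fun h => hpG (interior_subset h)⟩
  exact interior_subset hw' (interior_subset hw)

theorem exists_mem_frontier_dist_le {G : Set ℂ} {x p : ℂ} (hx : x ∈ G) (hp : p ∉ G) :
    ∃ z ∈ frontier G, dist x z ≤ dist x p := by
  obtain ⟨z, hz, hzG⟩ := (convex_segment x p).isPreconnected.inter_frontier_nonempty
    ⟨x, left_mem_segment ℝ x p, hx⟩ ⟨p, right_mem_segment ℝ x p, hp⟩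
  refine ⟨z, hzG, ?_⟩
  have := dist_add_dist_of_mem_segment hz
  linarith [dist_nonneg (x := z) (y := p)]

theorem distBd_le_dist {G : Set ℂ} {x p : ℂ} (hx : x ∈ G) (hp : p ∉ G) :
    distBd G x ≤ dist x p := by
  obtain ⟨z, hz, hzp⟩ := exists_mem_frontier_dist_le hx hp
  exact (infDist_le_dist_of_mem hz).trans hzp

theorem sub_mem_sector {θ : ℝ} (h₁ : Real.pi < θ) (h₂ : θ < 2 * Real.pi) {x z : ℂ}
    (hx : x ∈ sector θ) (hz : z ∉ sector θ) : x - z ∈ sector θ := by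
  rw [mem_sector_iff h₁ h₂] at *
  push Not at hz
  simp only [sub_re, sub_im]
  rcases hx with h | h
  · exact .inl (by linarith)
  · exact .inr (by linarith)

theorem add_notMem_sector {θ : ℝ} (h₁ : Real.pi < θ) (h₂ : θ < 2 * Real.pi) {x z : ℂ}
    (hx : x ∉ sector θ) (hz : z ∉ sector θ) : x + z ∉ sector θ := fun h =>
  hx (by simpa using sub_mem_sector h₁ h₂ h hz)

theorem ofReal_notMem_sector {θ t : ℝ} (h₁ : Real.pi < θ) (h₂ : θ < 2 * Real.pi) (ht : 0 ≤ t) :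
    (t : ℂ) ∉ sector θ := by
  have hs : Real.sin θ < 0 := by
    rw [← Real.sin_sub_two_pi]
    exact Real.sin_neg_of_neg_of_neg_pi_lt (by linarith) (by linarith)
  rw [mem_sector_iff h₁ h₂]
  push Not
  simp only [ofReal_re, ofReal_im]
  exact ⟨le_rfl, by nlinarith⟩

theorem ofReal_mul_exp_notMem_sector {θ t : ℝ} (h₁ : Real.pi < θ) (h₂ : θ < 2 * Real.pi)
    (ht : 0 ≤ t) : (t * exp (θ * I) : ℂ) ∉ sector θ := by
  have hs : Real.sin θ < 0 := by
    rw [← Real.sin_sub_two_pi]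
    exact Real.sin_neg_of_neg_of_neg_pi_lt (by linarith) (by linarith)
  rw [mem_sector_iff h₁ h₂]
  push Not
  simp only [re_ofReal_mul, im_ofReal_mul, exp_ofReal_mul_I_re, exp_ofReal_mul_I_im]
  exact ⟨by nlinarith, by linarith⟩

theorem norm_polar_sub_proj (r φ ψ : ℝ) (hr : 0 ≤ r) (h : 0 ≤ Real.sin (ψ - φ)) :
    ‖(r * exp (φ * I) - (r * Real.cos (ψ - φ) : ℝ) * exp (ψ * I) : ℂ)‖ =
      r * Real.sin (ψ - φ) := by
  rw [← sq_eq_sq₀ (norm_nonneg _) (mul_nonneg hr h), norm_polar_sub_polar_sq]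
  linear_combination -r ^ 2 * Real.sin_sq_add_cos_sq (ψ - φ)

theorem distBd_sector_le_left {θ r φ : ℝ} (h₁ : Real.pi < θ) (h₂ : θ < 2 * Real.pi) {x z : ℂ}
    (hx : x ∈ sector θ) (hz : z ∉ sector θ) (hr : 0 ≤ r) (hφ : 0 ≤ φ)
    (h : x - z = r * exp (φ * I)) :
    distBd (sector θ) x ≤ r * Real.sin (min φ (Real.pi / 2)) := by
  have hpi := Real.pi_pos
  rcases le_total φ (Real.pi / 2) with h' | h'
  · rw [min_eq_left h']
    have hc : 0 ≤ Real.cos φ := Real.cos_nonneg_of_neg_pi_div_two_le_of_le (by linarith) h'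
    refine (distBd_le_dist hx (add_notMem_sector h₁ h₂ hz
      (ofReal_notMem_sector h₁ h₂ (mul_nonneg hr hc)))).trans_eq ?_
    rw [dist_eq_norm, ← sub_sub, h,
      ← sq_eq_sq₀ (norm_nonneg _)
        (mul_nonneg hr (Real.sin_nonneg_of_nonneg_of_le_pi hφ (by linarith)))]
    have := norm_polar_sub_polar_sq r (r * Real.cos φ) φ 0
    simp only [ofReal_zero, zero_mul, Complex.exp_zero, mul_one, zero_sub, Real.cos_neg] at this
    rw [this]
    linear_combination -r ^ 2 * Real.sin_sq_add_cos_sq φ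
  · rw [min_eq_right h', Real.sin_pi_div_two, mul_one]
    refine (distBd_le_dist hx hz).trans_eq ?_
    rw [dist_eq_norm, h, norm_polar r φ hr]

theorem distBd_sector_le_right {θ r φ : ℝ} (h₁ : Real.pi < θ) (h₂ : θ < 2 * Real.pi) {x z : ℂ}
    (hx : x ∈ sector θ) (hz : z ∉ sector θ) (hr : 0 ≤ r) (hφ : φ ≤ θ)
    (h : x - z = r * exp (φ * I)) :
    distBd (sector θ) x ≤ r * Real.sin (min (θ - φ) (Real.pi / 2)) := by
  have hpi := Real.pi_pos
  rcases le_total (θ - φ) (Real.pi / 2) with h' | h'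
  · rw [min_eq_left h']
    have hc : 0 ≤ Real.cos (θ - φ) :=
      Real.cos_nonneg_of_neg_pi_div_two_le_of_le (by linarith) h'
    refine (distBd_le_dist hx (add_notMem_sector h₁ h₂ hz
      (ofReal_mul_exp_notMem_sector h₁ h₂ (mul_nonneg hr hc)))).trans_eq ?_
    rw [dist_eq_norm, ← sub_sub, h, norm_polar_sub_proj r φ θ hr
      (Real.sin_nonneg_of_nonneg_of_le_pi (by linarith) (by linarith))]
  · rw [min_eq_right h', Real.sin_pi_div_two, mul_one]
    refine (distBd_le_dist hx hz).trans_eq ?_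
    rw [dist_eq_norm, h, norm_polar r φ hr]

theorem dist_add_two_mul_min_distBd_le {θ : ℝ} (h₁ : Real.pi < θ) (h₂ : θ < 2 * Real.pi)
    {x y z : ℂ} (hx : x ∈ sector θ) (hy : y ∈ sector θ) (hz : z ∉ sector θ) :
    dist x y + 2 * min (distBd (sector θ) x) (distBd (sector θ) y) ≤
      2 * Real.sin (θ / 4) * (dist x z + dist z y) := by
  obtain ⟨r, φ, hr, hφ, hφ', hxz⟩ := sub_mem_sector h₁ h₂ hx hz
  obtain ⟨s, ψ, hs, hψ, hψ', hyz⟩ := sub_mem_sector h₁ h₂ hy hz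
  wlog hφψ : φ ≤ ψ generalizing x y r s φ ψ
  · have := this hy hx s ψ hs hψ hψ' hyz r φ hr hφ hφ' hxz (le_of_not_ge hφψ)
    rwa [dist_comm x y, min_comm, dist_comm x z, dist_comm z y, add_comm (dist z x)]
  have hdx : dist x z = r := by rw [dist_eq_norm, hxz, norm_polar r φ hr.le]
  have hdy : dist z y = s := by rw [dist_comm, dist_eq_norm, hyz, norm_polar s ψ hs.le]
  have hxy : dist x y = ‖(r * exp (φ * I) - s * exp (ψ * I) : ℂ)‖ := by
    rw [dist_eq_norm, ← hxz, ← hyz, sub_sub_sub_cancel_right]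
  rw [hdx, hdy, hxy]
  refine norm_polar_sub_add_two_mul_le (c := θ / 4) (by linarith) (by linarith) hr hs hφ.le hφψ
    (by linarith)
    ((min_le_left _ _).trans (distBd_sector_le_left h₁ h₂ hx hz hr.le hφ.le hxz)) ?_
  rw [mul_div_cancel₀ θ (four_ne_zero (α := ℝ))]
  exact (min_le_right _ _).trans (distBd_sector_le_right h₁ h₂ hy hz hs.le hψ'.le hyz)

theorem stmt_4 (θ : ℝ) (hθ : Real.pi < θ ∧ θ < 2 * Real.pi) :
    ∀ x ∈ sector θ, ∀ y ∈ sector θ,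
      triRatio (sector θ) x y ≤ 2 * Real.sin (θ / 4) * jStar (sector θ) x y := by
  obtain ⟨h₁, h₂⟩ := hθ
  intro x hx y hy
  have hk : 0 < 2 * Real.sin (θ / 4) :=
    mul_pos two_pos (Real.sin_pos_of_pos_of_lt_pi (by linarith [Real.pi_pos])
      (by linarith [Real.pi_pos]))
  rcases eq_or_ne x y with rfl | hxy
  · simp [triRatio, jStar]
  have hD : 0 < dist x y := dist_pos.2 hxy
  have h0 : (0 : ℂ) ∉ sector θ := by simpa using ofReal_notMem_sector h₁ h₂ le_rfl
  obtain ⟨z₀, hz₀, -⟩ := exists_mem_frontier_dist_le hx h0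
  have hden : 0 < dist x y + 2 * min (distBd (sector θ) x) (distBd (sector θ) y) :=
    add_pos_of_pos_of_nonneg hD
      (mul_nonneg zero_le_two (le_min infDist_nonneg infDist_nonneg))
  have hinf : (dist x y + 2 * min (distBd (sector θ) x) (distBd (sector θ) y)) /
      (2 * Real.sin (θ / 4)) ≤ sInf ((fun z => dist x z + dist z y) '' frontier (sector θ)) := by
    refine le_csInf ⟨_, z₀, hz₀, rfl⟩ ?_
    rintro _ ⟨z, hz, rfl⟩
    rw [(isOpen_sector h₁ h₂).frontier_eq] at hz
    rw [div_le_iff₀' hk]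
    exact dist_add_two_mul_min_distBd_le h₁ h₂ hx hy hz.2
  refine (div_le_div_of_nonneg_left hD.le (div_pos hden hk) hinf).trans_eq ?_
  rw [jStar, div_div_eq_mul_div, mul_comm (dist x y), mul_div_assoc]
end

section
/- For all x, y in the strip S_0 = {z ∈ ℂ : 0 < Im z < π}, the following inequalities hold: (1) j*_{S_0}(x,y) ≤ p_{S_0}(x,y) ≤ √2·j*_{S_0}(x,y); (2) j*_{S_0}(x,y) ≤ s_{S_0}(x,y) ≤ √2·j*_{S_0}(x,y); (3) p_{S_0}(x,y)/√2 ≤ s_{S_0}(x,y) ≤ p_{S_0}(x,y). -/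
open Set Metric Complex

/-- The strip `S₀ = {z : 0 < Im z < π}`. -/
noncomputable def strip : Set ℂ := {z : ℂ | 0 < z.im ∧ z.im < Real.pi}

/-- The boundary of the strip consists of the lines `Im z = 0` and `Im z = π`. -/
lemma mem_frontier_strip {z : ℂ} : z ∈ frontier strip ↔ z.im = 0 ∨ z.im = Real.pi := by
  have h : strip = Complex.im ⁻¹' Ioo 0 Real.pi := rfl
  rw [h, Complex.frontier_preimage_im, frontier_Ioo Real.pi_pos]
  simp

/-- The broken path `x → z → y` is at least as long as the segment from `x` to the reflection
of `y` in the horizontal line through `z`. -/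
lemma dist_sq_add_four_mul_im_le (x y z : ℂ) :
    dist x y ^ 2 + 4 * ((x.im - z.im) * (y.im - z.im)) ≤ (dist x z + dist z y) ^ 2 := by
  have key : (x.re - z.re) * (z.re - y.re) + (x.im - z.im) * (y.im - z.im)
      ≤ dist x z * dist z y := by
    rw [Complex.dist_eq_re_im, Complex.dist_eq_re_im, ← Real.sqrt_mul (by positivity)]
    apply Real.le_sqrt_of_sq_le
    nlinarith [sq_nonneg ((x.re - z.re) * (z.im - y.im) + (z.re - y.re) * (x.im - z.im))]
  have hsq (v w : ℂ) : dist v w ^ 2 = (v.re - w.re) ^ 2 + (v.im - w.im) ^ 2 := by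
    rw [Complex.dist_eq_re_im, Real.sq_sqrt (by positivity)]
  rw [add_sq, hsq x y, hsq x z, hsq z y]
  nlinarith

/-- The distance to the boundary of the strip is at most the vertical distance to any
boundary point. -/
lemma distBd_strip_le {x z : ℂ} (hz : z ∈ frontier strip) :
    distBd strip x ≤ |x.im - z.im| := by
  have hw : (⟨x.re, z.im⟩ : ℂ) ∈ frontier strip := by
    rw [mem_frontier_strip] at hz ⊢
    exact hz
  refine (infDist_le_dist_of_mem hw).trans_eq ?_
  exact Complex.dist_of_re_eq (w := ⟨x.re, z.im⟩) rfl

lemma dist_sq_add_le_of_mem_frontier_strip {x y z : ℂ} (hx : x ∈ strip) (hy : y ∈ strip)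
    (hz : z ∈ frontier strip) :
    dist x y ^ 2 + 4 * distBd strip x * distBd strip y ≤ (dist x z + dist z y) ^ 2 := by
  have hxy : 0 ≤ (x.im - z.im) * (y.im - z.im) := by
    rcases mem_frontier_strip.1 hz with h | h <;> rw [h]
    · exact mul_nonneg (by linarith [hx.1]) (by linarith [hy.1])
    · exact mul_nonneg_of_nonpos_of_nonpos (by linarith [hx.2]) (by linarith [hy.2])
  have hmul : distBd strip x * distBd strip y ≤ (x.im - z.im) * (y.im - z.im) := by
    rw [← abs_of_nonneg hxy, abs_mul]
    exact mul_le_mul (distBd_strip_le hz) (distBd_strip_le hz) infDist_nonneg (abs_nonneg _)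
  linarith [dist_sq_add_four_mul_im_le x y z]

lemma frontier_strip_nonempty : (frontier strip).Nonempty :=
  ⟨0, mem_frontier_strip.2 (Or.inl rfl)⟩

lemma bddBelow_dist_add_dist_image (S : Set ℂ) (x y : ℂ) :
    BddBelow ((fun z => dist x z + dist z y) '' S) :=
  ⟨0, by rintro _ ⟨z, -, rfl⟩; positivity⟩

lemma sInf_dist_add_dist_le {G : Set ℂ} (hG : (frontier G).Nonempty) (x y : ℂ) :
    sInf ((fun z => dist x z + dist z y) '' frontier G)
      ≤ dist x y + 2 * min (distBd G x) (distBd G y) := by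
  set I := sInf ((fun z => dist x z + dist z y) '' frontier G)
  have hI : ∀ z ∈ frontier G, I ≤ dist x z + dist z y := fun z hz =>
    csInf_le (bddBelow_dist_add_dist_image _ x y) (mem_image_of_mem _ hz)
  have h₁ : (I - dist x y) / 2 ≤ distBd G x := (le_infDist hG).2 fun z hz => by
    linarith [hI z hz, dist_triangle z x y, dist_comm z x]
  have h₂ : (I - dist x y) / 2 ≤ distBd G y := (le_infDist hG).2 fun z hz => by
    linarith [hI z hz, dist_triangle x y z, dist_comm z y]
  linarith [le_min h₁ h₂]

lemma sqrt_le_dist_add_two_mul_min (G : Set ℂ) (x y : ℂ) :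
    Real.sqrt (dist x y ^ 2 + 4 * distBd G x * distBd G y)
      ≤ dist x y + 2 * min (distBd G x) (distBd G y) := by
  have hx : 0 ≤ distBd G x := infDist_nonneg
  have hy : 0 ≤ distBd G y := infDist_nonneg
  have hxy : distBd G x ≤ distBd G y + dist x y := infDist_le_infDist_add_dist
  have hyx : distBd G y ≤ distBd G x + dist x y := by
    rw [dist_comm]; exact infDist_le_infDist_add_dist
  rw [Real.sqrt_le_left (by positivity)]
  rcases le_total (distBd G x) (distBd G y) with h | h
  · rw [min_eq_left h]; nlinarith
  · rw [min_eq_right h]; nlinarith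

lemma dist_add_two_mul_min_le_sqrt (G : Set ℂ) (x y : ℂ) :
    dist x y + 2 * min (distBd G x) (distBd G y)
      ≤ Real.sqrt 2 * Real.sqrt (dist x y ^ 2 + 4 * distBd G x * distBd G y) := by
  have hx : 0 ≤ distBd G x := infDist_nonneg
  have hy : 0 ≤ distBd G y := infDist_nonneg
  rw [← Real.sqrt_mul zero_le_two]
  apply Real.le_sqrt_of_sq_le
  rcases le_total (distBd G x) (distBd G y) with h | h
  · rw [min_eq_left h]; nlinarith [sq_nonneg (dist x y - 2 * distBd G x)]
  · rw [min_eq_right h]; nlinarith [sq_nonneg (dist x y - 2 * distBd G y)]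

theorem stmt_8 :
    ∀ x ∈ strip, ∀ y ∈ strip,
      (jStar strip x y ≤ pointPair strip x y ∧
        pointPair strip x y ≤ Real.sqrt 2 * jStar strip x y) ∧
      (jStar strip x y ≤ triRatio strip x y ∧
        triRatio strip x y ≤ Real.sqrt 2 * jStar strip x y) ∧
      (pointPair strip x y / Real.sqrt 2 ≤ triRatio strip x y ∧
        triRatio strip x y ≤ pointPair strip x y) := by
  intro x hx y hy
  rcases (dist_nonneg (x := x) (y := y)).eq_or_lt with hd | hd
  · simp [jStar, pointPair, triRatio, ← hd]
  have hdx : 0 ≤ distBd strip x := infDist_nonneg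
  have hdy : 0 ≤ distBd strip y := infDist_nonneg
  have hroot : 0 < Real.sqrt (dist x y ^ 2 + 4 * distBd strip x * distBd strip y) := by
    positivity
  have hroot_le : Real.sqrt (dist x y ^ 2 + 4 * distBd strip x * distBd strip y)
      ≤ sInf ((fun z => dist x z + dist z y) '' frontier strip) := by
    refine le_csInf (frontier_strip_nonempty.image _) ?_
    rintro _ ⟨z, hz, rfl⟩
    exact (Real.sqrt_le_left (by positivity)).2 (dist_sq_add_le_of_mem_frontier_strip hx hy hz)
  have hjp : jStar strip x y ≤ pointPair strip x y :=
    div_le_div_of_nonneg_left hd.le hroot (sqrt_le_dist_add_two_mul_min strip x y)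
  have hpj : pointPair strip x y ≤ Real.sqrt 2 * jStar strip x y := by
    rw [pointPair, jStar, ← mul_div_assoc, div_le_div_iff₀ hroot (by positivity)]
    nlinarith [mul_le_mul_of_nonneg_left (dist_add_two_mul_min_le_sqrt strip x y) hd.le]
  have hjs : jStar strip x y ≤ triRatio strip x y :=
    div_le_div_of_nonneg_left hd.le (hroot.trans_le hroot_le)
      (sInf_dist_add_dist_le frontier_strip_nonempty x y)
  have hsp : triRatio strip x y ≤ pointPair strip x y :=
    div_le_div_of_nonneg_left hd.le hroot hroot_le
  refine ⟨⟨hjp, hpj⟩, ⟨hjs, hsp.trans hpj⟩, ?_, hsp⟩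
  rw [div_le_iff₀' (by positivity)]
  exact hpj.trans (by gcongr)
end
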